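/- There exists a constant C > 0, depending only on q' and F, such that the following holds. For every m ≥ 1, every λ ≥ 0, and every pair (a, c) solving the mode-λ model system on (0,∞) with asymptotic data (c₀, 0, h) at τ = 0, one has: (1+λ²)·a(1)² + a'(1)² ≤ C·( m·h² + m⁻¹·λ²·h² + c₀² ). (This is the single spherical-harmonic-mode version of the paper's Corollary 3.4, the forward estimate for the regular component α_J at τ = 1.) -/

import Mathlib

open Set Filter

/-- The pair `(a, c)` solves the mode-`lam` model system on `I ⊆ (0,∞)`:
`a` is twice differentiable and `c` is differentiable on `I`, and for all `τ ∈ I`,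
(E) `a'' + τ⁻¹·a' + 4q'·a + 4λ²·(τ²+1)⁻²·a = f₁·τ·a' + f₂·τ²·a + f₃·c` and
(C) `c' = 2τ·a`. -/
def SolvesModelSystem (q' : ℝ) (f₁ f₂ f₃ : ℝ → ℝ) (lam : ℝ)
    (a c : ℝ → ℝ) (I : Set ℝ) : Prop :=
  ∀ τ ∈ I,
    DifferentiableAt ℝ a τ ∧ DifferentiableAt ℝ (deriv a) τ ∧ DifferentiableAt ℝ c τ ∧
    (deriv (deriv a) τ + τ⁻¹ * deriv a τ + 4 * q' * a τ
        + 4 * lam ^ 2 * ((τ ^ 2 + 1) ^ 2)⁻¹ * a τ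
      = f₁ τ * τ * deriv a τ + f₂ τ * τ ^ 2 * a τ + f₃ τ * c τ) ∧
    deriv c τ = 2 * τ * a τ

/-- The pair `(a, c)` (solving the model system on `(0,∞)`, with `c` extended
continuously to `[0,∞)`) has asymptotic data `(c₀, O, h)` at `τ = 0`. -/
def HasAsymptoticData (a c : ℝ → ℝ) (c₀ O h : ℝ) : Prop :=
  ContinuousOn c (Ici 0) ∧ c 0 = c₀ ∧
  ∃ K : ℝ, 0 ≤ K ∧ ∀ τ ∈ Ioc (0:ℝ) 1,
    |a τ - O * Real.log τ - h| ≤ K * τ ^ 2 * (1 + Real.log τ ^ 2) ∧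
    |deriv a τ - O / τ| ≤ K * τ * (1 + Real.log τ ^ 2)

open Topology

/-- The potential `4λ²(τ²+1)⁻² + 4q'` of the mode-`λ` model equation. -/
noncomputable def modePotential (q' lam τ : ℝ) : ℝ :=
  4 * lam ^ 2 * ((τ ^ 2 + 1) ^ 2)⁻¹ + 4 * q'

/-- The weighted energy `(τ+e)(a'² + w a²) + τ(τ+e)⁻¹ a a' + c²` of a pair `(a, c)`. -/
noncomputable def weightedEnergy (q' lam e : ℝ) (a c : ℝ → ℝ) (τ : ℝ) : ℝ :=
  (τ + e) * (deriv a τ ^ 2 + modePotential q' lam τ * a τ ^ 2)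
    + τ / (τ + e) * (a τ * deriv a τ) + c τ ^ 2

lemma le_modePotential {q' lam τ : ℝ} (hq : 1 ≤ q') (h₀ : 0 ≤ τ) (h₁ : τ ≤ 1) :
    lam ^ 2 + 4 ≤ modePotential q' lam τ := by
  have h : (4 : ℝ)⁻¹ ≤ ((τ ^ 2 + 1) ^ 2)⁻¹ := by
    apply inv_anti₀ (by positivity)
    have : τ ^ 2 ≤ 1 := by nlinarith
    nlinarith [sq_nonneg τ]
  unfold modePotential
  nlinarith [sq_nonneg lam, mul_le_mul_of_nonneg_left h (sq_nonneg lam)]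

lemma hasDerivAt_modePotential (q' lam τ : ℝ) :
    HasDerivAt (modePotential q' lam) (-(16 * lam ^ 2 * τ * ((τ ^ 2 + 1) ^ 3)⁻¹)) τ := by
  have h0 : τ ^ 2 + 1 ≠ 0 := by positivity
  have h := ((((((hasDerivAt_id τ).pow 2).add_const 1).pow 2).inv
    (pow_ne_zero 2 h0)).const_mul (4 * lam ^ 2)).add_const (4 * q')
  refine h.congr_deriv ?_
  simp
  field_simp
  ring

lemma abs_mul_le_energy {lam e w x y : ℝ} (hlam : 0 ≤ lam) (he : e * (1 + lam) = 1)
    (hw : lam ^ 2 + 4 ≤ w) : |x * y| ≤ e * (y ^ 2 + w * x ^ 2) := by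
  have he0 : 0 < e := by
    by_contra! h
    nlinarith
  have h : |x * y| * (1 + lam) ≤ y ^ 2 + w * x ^ 2 := by
    rw [abs_mul]
    have h1 : (1 + lam) ^ 2 / 4 * |x| ^ 2 ≤ w * |x| ^ 2 := by
      gcongr
      nlinarith [sq_nonneg (lam - 1)]
    rw [← sq_abs x, ← sq_abs y]
    nlinarith [sq_nonneg (|y| - (1 + lam) / 2 * |x|)]
  calc |x * y| = e * (|x * y| * (1 + lam)) := by linear_combination (-|x * y|) * he
    _ ≤ _ := by gcongr

/-- Coercivity of the weighted energy. -/
lemma energy_le_two_mul {lam e w τ x y : ℝ} (hlam : 0 ≤ lam) (he : e * (1 + lam) = 1)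
    (he0 : 0 < e) (hw : lam ^ 2 + 4 ≤ w) (hτ : 0 ≤ τ) :
    (τ + e) * (y ^ 2 + w * x ^ 2)
      ≤ 2 * ((τ + e) * (y ^ 2 + w * x ^ 2) + τ / (τ + e) * (x * y)) := by
  have hS : 0 ≤ y ^ 2 + w * x ^ 2 := by
    have : 0 ≤ w := by nlinarith [sq_nonneg lam]
    positivity
  have hχ : τ / (τ + e) * e * 2 ≤ τ + e := by
    have hp : 0 < τ + e := by positivity
    rw [div_mul_eq_mul_div, div_mul_eq_mul_div, div_le_iff₀ hp]
    nlinarith [sq_nonneg (τ - e), sq_nonneg τ, sq_nonneg e]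
  have h := abs_mul_le_energy (x := x) (y := y) hlam he hw
  have hχ0 : 0 ≤ τ / (τ + e) := by positivity
  have h1 := mul_le_mul_of_nonneg_left h hχ0
  have h2 := mul_le_mul_of_nonneg_left (neg_abs_le (x * y)) hχ0
  nlinarith [mul_le_mul_of_nonneg_right hχ hS]

/-- Bound for the contribution of the forcing terms to the energy identity. -/
lemma forcing_le {F f₁ f₂ f₃ lam e w τ x y z : ℝ} (hlam : 0 ≤ lam) (he : e * (1 + lam) = 1)
    (he0 : 0 < e) (hw : lam ^ 2 + 4 ≤ w) (hτ : 0 ≤ τ) (hτ1 : τ ≤ 1) (h₁ : |f₁| ≤ F)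
    (h₂ : |f₂| ≤ F) (h₃ : |f₃| ≤ F) :
    (2 * (τ + e) * y + τ / (τ + e) * x) * (f₁ * τ * y + f₂ * τ ^ 2 * x + f₃ * z)
      + 4 * τ * x * z ≤ (7 * F + 2) * ((τ + e) * (y ^ 2 + w * x ^ 2) + z ^ 2) := by
  have hF : 0 ≤ F := (abs_nonneg _).trans h₁
  have hp : 0 < τ + e := by positivity
  have he1 : e ≤ 1 := by nlinarith
  have hew : 1 ≤ e * w := by
    calc (1 : ℝ) = e * (1 + lam) := he.symm
      _ ≤ e * w := by
        gcongr
        nlinarith [sq_nonneg (lam - 1)]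
  have hw1 : 1 ≤ w := by nlinarith [sq_nonneg lam]
  have hxy := abs_mul_le_energy (x := x) (y := y) hlam he hw
  set S := y ^ 2 + w * x ^ 2 with hSdef
  have hS : 0 ≤ S := by positivity
  set N := (τ + e) * S with hN
  have hxyN : |x| * |y| ≤ N := by
    rw [← abs_mul]
    linarith [mul_nonneg hτ hS]
  have hxN : |x| ^ 2 ≤ N := by
    rw [sq_abs, hN, add_mul]
    have h1 : e * S = e * y ^ 2 + e * w * x ^ 2 := by
      rw [hSdef]
      ring
    linarith [mul_le_mul_of_nonneg_right hew (sq_nonneg x), mul_nonneg hτ hS,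
      mul_nonneg he0.le (sq_nonneg y)]
  have hg : |f₁ * τ * y + f₂ * τ ^ 2 * x + f₃ * z| ≤ F * (|y| + |x| + |z|) := by
    have hτ2 : τ ^ 2 ≤ 1 := by nlinarith
    have e1 : |f₁ * τ * y| ≤ F * |y| := by
      rw [abs_mul, abs_mul, abs_of_nonneg hτ]
      gcongr
      exact (mul_le_of_le_one_right (abs_nonneg _) hτ1).trans h₁
    have e2 : |f₂ * τ ^ 2 * x| ≤ F * |x| := by
      rw [abs_mul, abs_mul, abs_of_nonneg (sq_nonneg τ)]
      gcongr
      exact (mul_le_of_le_one_right (abs_nonneg _) hτ2).trans h₂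
    have e3 : |f₃ * z| ≤ F * |z| := by
      rw [abs_mul]
      gcongr
    calc _ ≤ |f₁ * τ * y| + |f₂ * τ ^ 2 * x| + |f₃ * z| := abs_add_three _ _ _
      _ ≤ _ := by linarith
  have hχ0 : 0 ≤ τ / (τ + e) := by positivity
  have hχ1 : τ / (τ + e) ≤ 1 := by
    rw [div_le_one hp]
    linarith
  have hl : |2 * (τ + e) * y + τ / (τ + e) * x| ≤ 2 * (τ + e) * |y| + |x| := by
    refine (abs_add_le _ _).trans ?_
    rw [abs_mul, abs_mul _ x, abs_of_nonneg hχ0, abs_of_nonneg (by positivity : 0 ≤ 2 * (τ + e))]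
    gcongr
    exact mul_le_of_le_one_left (abs_nonneg x) hχ1
  have hmul : (2 * (τ + e) * y + τ / (τ + e) * x) * (f₁ * τ * y + f₂ * τ ^ 2 * x + f₃ * z)
      ≤ (2 * (τ + e) * |y| + |x|) * (F * (|y| + |x| + |z|)) := by
    refine (le_abs_self _).trans ?_
    rw [abs_mul]
    gcongr
  have hyN : (τ + e) * |y| ^ 2 ≤ N := by
    rw [hN, sq_abs]
    have h1 : y ^ 2 ≤ S := by
      have : 0 ≤ w * x ^ 2 := by positivity
      linarith
    exact mul_le_mul_of_nonneg_left h1 hp.le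
  have hxyp : (τ + e) * (2 * |x| * |y|) ≤ N := by
    have h1 : x ^ 2 ≤ w * x ^ 2 := le_mul_of_one_le_left (sq_nonneg x) hw1
    have h2 : 2 * |x| * |y| ≤ S := by
      rw [hSdef]
      linarith [sq_nonneg (|x| - |y|), sq_abs x, sq_abs y]
    exact mul_le_mul_of_nonneg_left h2 hp.le
  have hyz : (τ + e) * (2 * |y| * |z|) ≤ N + 2 * z ^ 2 := by
    have : (τ + e) * (2 * |y| * |z|) ≤ (τ + e) * (|y| ^ 2 + |z| ^ 2) := by
      refine mul_le_mul_of_nonneg_left ?_ hp.le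
      linarith [sq_nonneg (|y| - |z|)]
    rw [sq_abs z] at this
    nlinarith [mul_nonneg (by linarith : 0 ≤ 2 - (τ + e)) (sq_nonneg z)]
  have hxz : 2 * |x| * |z| ≤ N + z ^ 2 := by
    rw [← sq_abs z]
    linarith [sq_nonneg (|x| - |z|)]
  have hN0 : 0 ≤ N := by positivity
  have hsum : (2 * (τ + e) * |y| + |x|) * (|y| + |x| + |z|) ≤ 7 * (N + z ^ 2) := by
    linarith [sq_nonneg z]
  have hc : 4 * τ * x * z ≤ 2 * (N + z ^ 2) := by
    have h1 : x * z ≤ |x| * |z| := by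
      rw [← abs_mul]
      exact le_abs_self _
    have h2 : τ * (x * z) ≤ |x| * |z| :=
      (mul_le_mul_of_nonneg_left h1 hτ).trans
        (mul_le_of_le_one_left (by positivity) hτ1)
    linarith [sq_nonneg z]
  linarith [mul_le_mul_of_nonneg_left hsum hF]

lemma hasDerivAt_weightedEnergy {q' lam e τ a'' : ℝ} {a c : ℝ → ℝ} (hp : τ + e ≠ 0)
    (ha : DifferentiableAt ℝ a τ) (ha' : HasDerivAt (deriv a) a'' τ)
    (hc : HasDerivAt c (2 * τ * a τ) τ) :
    HasDerivAt (weightedEnergy q' lam e a c)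
      ((deriv a τ ^ 2 + modePotential q' lam τ * a τ ^ 2)
        + (τ + e) * (2 * deriv a τ * a''
          + (-(16 * lam ^ 2 * τ * ((τ ^ 2 + 1) ^ 3)⁻¹) * a τ ^ 2
            + modePotential q' lam τ * (2 * a τ * deriv a τ)))
        + (e / (τ + e) ^ 2 * (a τ * deriv a τ)
          + τ / (τ + e) * (deriv a τ ^ 2 + a τ * a''))
        + 4 * τ * a τ * c τ) τ := by
  have hid := (hasDerivAt_id τ).add_const e
  have hχ := (hasDerivAt_id τ).div hid hp
  have h := ((hid.mul ((ha'.pow 2).add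
    ((hasDerivAt_modePotential q' lam τ).mul (ha.hasDerivAt.pow 2)))).add
    (hχ.mul (ha.hasDerivAt.mul ha'))).add (hc.pow 2)
  refine h.congr_deriv ?_
  simp
  field_simp
  ring

/-- Differential inequality for the weighted energy. -/
lemma deriv_weightedEnergy_le {q' F lam e τ : ℝ} {f₁ f₂ f₃ a c : ℝ → ℝ} (hq : 1 ≤ q')
    (hlam : 0 ≤ lam) (he : e * (1 + lam) = 1) (he0 : 0 < e) (hτ : 0 < τ) (hτ1 : τ ≤ 1)
    (h₁ : |f₁ τ| ≤ F) (h₂ : |f₂ τ| ≤ F) (h₃ : |f₃ τ| ≤ F)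
    (hs : SolvesModelSystem q' f₁ f₂ f₃ lam a c (Ioi 0)) :
    ∃ Z', HasDerivAt (weightedEnergy q' lam e a c) Z' τ ∧
      Z' ≤ (4 * e / (τ + e) ^ 2 + (14 * F + 4)) * weightedEnergy q' lam e a c τ := by
  obtain ⟨ha, ha', hc, hE, hC⟩ := hs τ hτ
  have hp : 0 < τ + e := by positivity
  have hcd := hc.hasDerivAt
  rw [hC] at hcd
  refine ⟨_, hasDerivAt_weightedEnergy hp.ne' ha ha'.hasDerivAt hcd, ?_⟩
  have hF : 0 ≤ F := (abs_nonneg _).trans h₁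
  have hw := le_modePotential (lam := lam) hq hτ.le hτ1
  have hE' : deriv (deriv a) τ = -(deriv a τ / τ) - modePotential q' lam τ * a τ
      + (f₁ τ * τ * deriv a τ + f₂ τ * τ ^ 2 * a τ + f₃ τ * c τ) := by
    rw [← hE, modePotential]
    ring
  have hforce := forcing_le (x := a τ) (y := deriv a τ) (z := c τ) hlam he he0 hw hτ.le hτ1
    h₁ h₂ h₃
  have hxy := abs_mul_le_energy (x := a τ) (y := deriv a τ) hlam he hw
  have hco := energy_le_two_mul (x := a τ) (y := deriv a τ) hlam he he0 hw hτ.le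
  rw [hE']
  unfold weightedEnergy
  set w := modePotential q' lam τ
  set x := a τ
  set y := deriv a τ
  set z := c τ
  set g := f₁ τ * τ * y + f₂ τ * τ ^ 2 * x + f₃ τ * z
  set Q := (τ + e) * (y ^ 2 + w * x ^ 2) + τ / (τ + e) * (x * y)
  have hw0 : 0 ≤ w := by nlinarith [sq_nonneg lam]
  set S := y ^ 2 + w * x ^ 2 with hS
  have hS0 : 0 ≤ S := by positivity
  clear_value g
  have hid : S + (τ + e) * (2 * y * (-(y / τ) - w * x + g)
        + (-(16 * lam ^ 2 * τ * ((τ ^ 2 + 1) ^ 3)⁻¹) * x ^ 2 + w * (2 * x * y)))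
      + (e / (τ + e) ^ 2 * (x * y) + τ / (τ + e) * (y ^ 2 + x * (-(y / τ) - w * x + g)))
      + 4 * τ * x * z
      = e / (τ + e) * S - 2 * (e / τ + e / (τ + e)) * y ^ 2
        - (τ + e) * (16 * lam ^ 2 * τ * ((τ ^ 2 + 1) ^ 3)⁻¹) * x ^ 2
        - τ / (τ + e) ^ 2 * (x * y)
        + ((2 * (τ + e) * y + τ / (τ + e) * x) * g + 4 * τ * x * z) := by
    rw [hS]
    field_simp
    ring
  rw [hid]
  have d1 : 0 ≤ 2 * (e / τ + e / (τ + e)) * y ^ 2 := by positivity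
  have d2 : 0 ≤ (τ + e) * (16 * lam ^ 2 * τ * ((τ ^ 2 + 1) ^ 3)⁻¹) * x ^ 2 := by positivity
  have d3 : -(τ / (τ + e) ^ 2 * (x * y)) ≤ e / (τ + e) * S := by
    have hb : τ / (τ + e) ^ 2 ≤ 1 / (τ + e) := by
      rw [div_le_div_iff₀ (by positivity) hp]
      nlinarith
    calc -(τ / (τ + e) ^ 2 * (x * y)) = τ / (τ + e) ^ 2 * (-(x * y)) := by ring
      _ ≤ τ / (τ + e) ^ 2 * |x * y| := by
        gcongr
        exact neg_le_abs _
      _ ≤ 1 / (τ + e) * (e * S) := by gcongr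
      _ = e / (τ + e) * S := by ring
  have d4 : e / (τ + e) * S = e / (τ + e) ^ 2 * ((τ + e) * S) := by
    field_simp
  have d5 := mul_le_mul_of_nonneg_left hco (by positivity : 0 ≤ 2 * e / (τ + e) ^ 2)
  have d6 : (7 * F + 2) * ((τ + e) * S + z ^ 2) ≤ (7 * F + 2) * (2 * (Q + z ^ 2)) := by
    refine mul_le_mul_of_nonneg_left ?_ (by positivity)
    linarith [sq_nonneg z]
  have d7 : 0 ≤ 4 * e / (τ + e) ^ 2 * z ^ 2 := by positivity
  calc _ ≤ 2 * e / (τ + e) ^ 2 * ((τ + e) * S) + (7 * F + 2) * ((τ + e) * S + z ^ 2) := by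
        have d8 : 2 * e / (τ + e) ^ 2 * ((τ + e) * S) = 2 * (e / (τ + e) * S) := by
          rw [d4]
          ring
        linarith
    _ ≤ 2 * e / (τ + e) ^ 2 * (2 * Q) + (7 * F + 2) * (2 * (Q + z ^ 2)) := add_le_add d5 d6
    _ = 4 * e / (τ + e) ^ 2 * Q + (14 * F + 4) * (Q + z ^ 2) := by ring
    _ ≤ _ := by linarith

lemma tendsto_mul_one_add_log_sq :
    Tendsto (fun τ : ℝ => τ * (1 + Real.log τ ^ 2)) (𝓝[>] 0) (𝓝 0) := by
  have h := (tendsto_log_mul_rpow_nhdsGT_zero (r := 1 / 2) (by norm_num)).pow 2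
  have hid : Tendsto (fun τ : ℝ => τ) (𝓝[>] 0) (𝓝 0) :=
    tendsto_nhdsWithin_of_tendsto_nhds tendsto_id
  have h2 := hid.add h
  simp only [ne_eq, OfNat.ofNat_ne_zero, not_false_eq_true, zero_pow, add_zero] at h2
  refine h2.congr' ?_
  filter_upwards [self_mem_nhdsWithin] with τ hτ
  have : (τ ^ (1 / 2 : ℝ)) ^ 2 = τ := by
    rw [← Real.sqrt_eq_rpow, Real.sq_sqrt (le_of_lt hτ)]
  rw [mul_pow, this]
  ring

lemma HasAsymptoticData.tendsto {a c : ℝ → ℝ} {c₀ h : ℝ} (H : HasAsymptoticData a c c₀ 0 h) :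
    Tendsto a (𝓝[>] 0) (𝓝 h) ∧ Tendsto (deriv a) (𝓝[>] 0) (𝓝 0) ∧
      Tendsto c (𝓝[>] 0) (𝓝 c₀) := by
  obtain ⟨hc, hc0, K, hK, hb⟩ := H
  have hlim := tendsto_mul_one_add_log_sq.const_mul K
  rw [mul_zero] at hlim
  have hmem : ∀ᶠ τ : ℝ in 𝓝[>] 0, τ ∈ Ioc (0 : ℝ) 1 := Ioc_mem_nhdsGT one_pos
  refine ⟨?_, ?_, ?_⟩
  · rw [tendsto_iff_norm_sub_tendsto_zero]
    refine squeeze_zero' (Eventually.of_forall fun _ => norm_nonneg _) ?_ hlim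
    filter_upwards [hmem] with τ hτ
    have h1 := (hb τ hτ).1
    rw [zero_mul, sub_zero] at h1
    refine h1.trans ?_
    rw [mul_assoc]
    gcongr
    nlinarith [hτ.1, hτ.2]
  · refine squeeze_zero_norm' ?_ hlim
    filter_upwards [hmem] with τ hτ
    have h1 := (hb τ hτ).2
    rw [zero_div, sub_zero, mul_assoc] at h1
    exact h1
  · rw [← hc0]
    exact ((hc 0 self_mem_Ici).mono Ioi_subset_Ici_self)

/-- Integrated form of the differential inequality on `(0, 1]`. -/
lemma weightedEnergy_one_le {q' F lam e : ℝ} {f₁ f₂ f₃ a c : ℝ → ℝ} {c₀ h : ℝ} (hq : 1 ≤ q')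
    (hlam : 0 ≤ lam) (he : e * (1 + lam) = 1) (he0 : 0 < e)
    (h₁ : ∀ τ ≥ (0 : ℝ), |f₁ τ| ≤ F) (h₂ : ∀ τ ≥ (0 : ℝ), |f₂ τ| ≤ F)
    (h₃ : ∀ τ ≥ (0 : ℝ), |f₃ τ| ≤ F)
    (hs : SolvesModelSystem q' f₁ f₂ f₃ lam a c (Ioi 0)) (H : HasAsymptoticData a c c₀ 0 h) :
    weightedEnergy q' lam e a c 1 * Real.exp (4 * e / (1 + e) - (14 * F + 4))
      ≤ (e * ((4 * lam ^ 2 + 4 * q') * h ^ 2) + c₀ ^ 2) * Real.exp 4 := by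
  set Z := weightedEnergy q' lam e a c
  set φ : ℝ → ℝ := fun τ => 4 * e / (τ + e) - (14 * F + 4) * τ
  have hφ : ∀ τ, 0 ≤ τ → HasDerivAt φ (-(4 * e / (τ + e) ^ 2 + (14 * F + 4))) τ := by
    intro τ hτ
    have hp : τ + e ≠ 0 := by positivity
    have h := ((hasDerivAt_const τ (4 * e)).div ((hasDerivAt_id τ).add_const e) hp).sub
      ((hasDerivAt_id τ).const_mul (14 * F + 4))
    refine h.congr_deriv ?_
    simp
    ring
  have hder : ∀ τ ∈ Ioc (0 : ℝ) 1, ∃ G', HasDerivAt (fun τ => Z τ * Real.exp (φ τ)) G' τ ∧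
      G' ≤ 0 := by
    intro τ hτ
    obtain ⟨Z', hZ, hle⟩ := deriv_weightedEnergy_le hq hlam he he0 hτ.1 hτ.2 (h₁ τ hτ.1.le)
      (h₂ τ hτ.1.le) (h₃ τ hτ.1.le) hs
    refine ⟨_, hZ.mul (hφ τ hτ.1.le).exp, ?_⟩
    nlinarith [mul_le_mul_of_nonneg_right hle (Real.exp_pos (φ τ)).le]
  have hanti : AntitoneOn (fun τ => Z τ * Real.exp (φ τ)) (Ioc 0 1) := by
    refine antitoneOn_of_deriv_nonpos (convex_Ioc 0 1) ?_ ?_ ?_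
    · intro τ hτ
      obtain ⟨G', hG, -⟩ := hder τ hτ
      exact hG.continuousAt.continuousWithinAt
    · intro τ hτ
      obtain ⟨G', hG, -⟩ := hder τ (interior_subset hτ)
      exact hG.differentiableAt.differentiableWithinAt
    · intro τ hτ
      obtain ⟨G', hG, hle⟩ := hder τ (interior_subset hτ)
      rwa [hG.deriv]
  obtain ⟨ta, ta', tc⟩ := H.tendsto
  have hid : Tendsto (fun τ : ℝ => τ) (𝓝[>] 0) (𝓝 0) :=
    tendsto_nhdsWithin_of_tendsto_nhds tendsto_id
  have tw : Tendsto (modePotential q' lam) (𝓝[>] 0) (𝓝 (modePotential q' lam 0)) :=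
    tendsto_nhdsWithin_of_tendsto_nhds (hasDerivAt_modePotential q' lam 0).continuousAt
  have tφ : Tendsto φ (𝓝[>] 0) (𝓝 (φ 0)) :=
    tendsto_nhdsWithin_of_tendsto_nhds (hφ 0 le_rfl).continuousAt
  have tp := hid.add_const e
  have tZ : Tendsto (fun τ => Z τ * Real.exp (φ τ)) (𝓝[>] 0)
      (𝓝 (((0 + e) * (0 ^ 2 + modePotential q' lam 0 * h ^ 2) + 0 / (0 + e) * (h * 0)
        + c₀ ^ 2) * Real.exp (φ 0))) :=
    (((tp.mul ((ta'.pow 2).add (tw.mul (ta.pow 2)))).add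
      ((hid.div tp (by positivity)).mul (ta.mul ta'))).add (tc.pow 2)).mul
      ((Real.continuous_exp.tendsto _).comp tφ)
  have hle := ge_of_tendsto tZ (b := Z 1 * Real.exp (φ 1)) (by
    filter_upwards [Ioc_mem_nhdsGT (one_pos : (0 : ℝ) < 1)] with τ hτ
    exact hanti hτ ⟨one_pos, le_rfl⟩ hτ.2)
  have hφ0 : φ 0 = 4 := by
    simp only [φ]
    field_simp
    ring
  have hw0 : modePotential q' lam 0 = 4 * lam ^ 2 + 4 * q' := by
    simp [modePotential]
  rw [hφ0, hw0] at hle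
  simpa [φ] using hle

/-- Forward estimate for the regular component at `τ = 1` (single-mode version of
Corollary 3.4 of the paper). -/
theorem forward_estimate_regular (q' F : ℝ) (hq : 1 ≤ q') (hF : 0 ≤ F) :
    ∃ C > 0, ∀ f₁ f₂ f₃ : ℝ → ℝ,
      ContinuousOn f₁ (Ici 0) → ContinuousOn f₂ (Ici 0) → ContinuousOn f₃ (Ici 0) →
      (∀ τ ≥ (0:ℝ), |f₁ τ| ≤ F) → (∀ τ ≥ (0:ℝ), |f₂ τ| ≤ F) → (∀ τ ≥ (0:ℝ), |f₃ τ| ≤ F) →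
      ∀ m lam : ℝ, 1 ≤ m → 0 ≤ lam →
      ∀ a c : ℝ → ℝ, ∀ c₀ h : ℝ,
      SolvesModelSystem q' f₁ f₂ f₃ lam a c (Ioi 0) →
      HasAsymptoticData a c c₀ 0 h →
      (1 + lam ^ 2) * a 1 ^ 2 + deriv a 1 ^ 2
        ≤ C * (m * h ^ 2 + lam ^ 2 * h ^ 2 / m + c₀ ^ 2) := by
  refine ⟨16 * q' * Real.exp (4 + (14 * F + 4)), by positivity, ?_⟩
  intro f₁ f₂ f₃ _ _ _ h₁ h₂ h₃ m lam hm hlam a c c₀ h hs H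
  have hL : 0 < 1 + lam := by positivity
  set e := (1 + lam)⁻¹ with he_def
  have he0 : 0 < e := by positivity
  have he : e * (1 + lam) = 1 := inv_mul_cancel₀ hL.ne'
  have hmain := weightedEnergy_one_le hq hlam he he0 h₁ h₂ h₃ hs H
  have hw := le_modePotential (lam := lam) hq zero_le_one le_rfl
  have hco := energy_le_two_mul (x := a 1) (y := deriv a 1) hlam he he0 hw zero_le_one
  set Z := weightedEnergy q' lam e a c 1 with hZ
  set D := m * h ^ 2 + lam ^ 2 * h ^ 2 / m + c₀ ^ 2 with hD
  have hlow : (1 + lam ^ 2) * a 1 ^ 2 + deriv a 1 ^ 2 ≤ 2 * Z := by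
    have h1 : (1 + lam ^ 2) * a 1 ^ 2 ≤ modePotential q' lam 1 * a 1 ^ 2 := by
      gcongr
      linarith
    have h2 : 0 ≤ deriv a 1 ^ 2 + modePotential q' lam 1 * a 1 ^ 2 := by
      have : 0 ≤ (1 + lam ^ 2) * a 1 ^ 2 := by positivity
      linarith [sq_nonneg (deriv a 1)]
    rw [hZ, weightedEnergy]
    nlinarith [mul_nonneg he0.le h2, sq_nonneg (c 1)]
  have hm0 : 0 < m := by linarith
  have hm2 : 1 + lam ≤ 2 * (m + lam ^ 2 / m) := by
    have : 2 * lam ≤ m + lam ^ 2 / m := by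
      rw [← sub_nonneg]
      have : m + lam ^ 2 / m - 2 * lam = (m - lam) ^ 2 / m := by
        field_simp
        ring
      rw [this]
      positivity
    have : 0 ≤ lam ^ 2 / m := by positivity
    linarith
  have hinit : e * ((4 * lam ^ 2 + 4 * q') * h ^ 2) + c₀ ^ 2 ≤ 8 * q' * D := by
    have h1 : e * (4 * lam ^ 2 + 4 * q') ≤ 4 * q' * (1 + lam) := by
      rw [he_def, inv_mul_le_iff₀ hL]
      nlinarith [mul_nonneg (sub_nonneg.2 hq) (sq_nonneg lam),
        mul_nonneg (zero_le_one.trans hq) hlam]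
    have h2 : 4 * q' * (1 + lam) ≤ 8 * q' * (m + lam ^ 2 / m) := by
      nlinarith
    have h3 := mul_le_mul_of_nonneg_right (h1.trans h2) (sq_nonneg h)
    have h4 : 8 * q' * D = 8 * q' * (m + lam ^ 2 / m) * h ^ 2 + 8 * q' * c₀ ^ 2 := by
      rw [hD]
      ring
    rw [h4]
    nlinarith [sq_nonneg c₀]
  have hexp : Real.exp (-(14 * F + 4)) ≤ Real.exp (4 * e / (1 + e) - (14 * F + 4)) := by
    apply Real.exp_le_exp.2
    have : 0 ≤ 4 * e / (1 + e) := by positivity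
    linarith
  have hZ0 : 0 ≤ Z := by
    have : 0 ≤ (1 + lam ^ 2) * a 1 ^ 2 + deriv a 1 ^ 2 := by positivity
    linarith
  have hfin : Z ≤ 8 * q' * D * Real.exp (4 + (14 * F + 4)) := by
    have h1 : Z * Real.exp (-(14 * F + 4)) ≤ 8 * q' * D * Real.exp 4 :=
      (mul_le_mul_of_nonneg_left hexp hZ0).trans
        (hmain.trans (mul_le_mul_of_nonneg_right hinit (Real.exp_pos 4).le))
    rw [Real.exp_neg, ← div_eq_mul_inv, div_le_iff₀ (Real.exp_pos _)] at h1
    rwa [Real.exp_add, ← mul_assoc]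
  linarith
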